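/- arXiv:2211.05204 — 10 statements merged into one kernel-verified Lean document; each statement's English description precedes it below -/
import Mathlib

section
/- Let G be an abelian group with the property that every additive endomorphism of G is a finite sum of automorphisms of G. Then a subgroup X of G is fully inert if, and only if, it is characteristically inert. -/
section Defs

variable {G : Type*} [AddCommGroup G]

/-- For a subgroup `X` of `G` and an endomorphism `φ` of `G`, `hatImage X φ` is the image
of `φ(X)` in the quotient `G ⧸ X`, i.e. the subgroup `(φ(X) + X)/X`. -/
def hatImage (X : AddSubgroup G) (φ : G →+ G) : AddSubgroup (G ⧸ X) :=
  (AddSubgroup.map φ X).map (QuotientAddGroup.mk' X)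

/-- `X` is fully invariant: stable under every additive endomorphism of `G`. -/
def FullyInvariantSub (X : AddSubgroup G) : Prop :=
  ∀ φ : G →+ G, AddSubgroup.map φ X ≤ X

/-- `X` is characteristic: stable under every additive automorphism of `G`. -/
def CharacteristicSub (X : AddSubgroup G) : Prop :=
  ∀ φ : G ≃+ G, AddSubgroup.map φ.toAddMonoidHom X ≤ X

/-- `X` is fully inert: `φ̂(X)` is finite for every endomorphism `φ` of `G`. -/
def FullyInertSub (X : AddSubgroup G) : Prop :=
  ∀ φ : G →+ G, Finite (hatImage X φ)

/-- `X` is characteristically inert: `φ̂(X)` is finite for every automorphism `φ` of `G`. -/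
def CharInertSub (X : AddSubgroup G) : Prop :=
  ∀ φ : G ≃+ G, Finite (hatImage X φ.toAddMonoidHom)

/-- Two subgroups are commensurable if their intersection has finite index in each of them. -/
def Commens (X Y : AddSubgroup G) : Prop :=
  ((X ⊓ Y).addSubgroupOf X).index ≠ 0 ∧ ((X ⊓ Y).addSubgroupOf Y).index ≠ 0

/-- `G` has minimal full inertia: every fully inert subgroup is commensurable with a
fully invariant subgroup. -/
def MinFullInertia (G : Type*) [AddCommGroup G] : Prop :=
  ∀ X : AddSubgroup G, FullyInertSub X → ∃ Y : AddSubgroup G, FullyInvariantSub Y ∧ Commens X Y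

/-- `G` has minimal characteristic inertia: every characteristically inert subgroup is
commensurable with a characteristic subgroup. -/
def MinCharInertia (G : Type*) [AddCommGroup G] : Prop :=
  ∀ X : AddSubgroup G, CharInertSub X → ∃ Y : AddSubgroup G, CharacteristicSub Y ∧ Commens X Y

/-- `G` is a `p`-group: every element is killed by some power of `p`. -/
def IsPGroup' (p : ℕ) (G : Type*) [AddCommGroup G] : Prop :=
  ∀ x : G, ∃ n : ℕ, p ^ n • x = 0

/-- Multiplication by `m` as an additive endomorphism of `G`. -/
def smulHom (m : ℕ) : G →+ G where
  toFun x := m • x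
  map_zero' := smul_zero m
  map_add' a b := smul_add m a b

/-- The subgroup `pⁿG`. -/
def pPowSub (p n : ℕ) : AddSubgroup G :=
  AddSubgroup.map (smulHom (p ^ n)) ⊤

/-- The subgroup `B[m] = {x ∈ B : m • x = 0}`. -/
def torSub (m : ℕ) (B : AddSubgroup G) : AddSubgroup G :=
  B ⊓ (smulHom m).ker

/-- The subgroup `mB = {m • x : x ∈ B}`. -/
def smulSub (m : ℕ) (B : AddSubgroup G) : AddSubgroup G :=
  AddSubgroup.map (smulHom m) B

/-- The `p`-height of `x` in `G`: the supremum in `ℕ∞` of the set of `n` with `x ∈ pⁿG`. -/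
noncomputable def pHeight (p : ℕ) (x : G) : ℕ∞ :=
  ⨆ n ∈ {n : ℕ | x ∈ (pPowSub p n : AddSubgroup G)}, (n : ℕ∞)

/-- `G` is transitive: any two elements with identical height sequences are connected by
an automorphism. -/
def TransitiveP (p : ℕ) (G : Type*) [AddCommGroup G] : Prop :=
  ∀ x y : G, (∀ n : ℕ, pHeight p (p ^ n • x) = pHeight p (p ^ n • y)) →
    ∃ φ : G ≃+ G, φ x = y

/-- `G` is separable: `p^ω G = ⋂ₙ pⁿG = 0`. -/
def SeparableP (p : ℕ) (G : Type*) [AddCommGroup G] : Prop :=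
  (⨅ n : ℕ, (pPowSub p n : AddSubgroup G)) = ⊥

end Defs

/-- Proposition 2.2(c): if every endomorphism of `G` is a finite sum of automorphisms, then a
subgroup is fully inert iff it is characteristically inert. -/
theorem stmt_2 {G : Type*} [AddCommGroup G]
    (hsum : ∀ γ : G →+ G, ∃ (k : ℕ) (φ : Fin k → (G ≃+ G)),
      ∀ x : G, γ x = ∑ i, (φ i) x)
    (X : AddSubgroup G) :
    FullyInertSub X ↔ CharInertSub X := by
  constructor
  · intro h φ
    exact h φ.toAddMonoidHom
  · intro h γ
    obtain ⟨k, φ, hφ⟩ := hsum γ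
    have hfin : ∀ i, Finite (hatImage X (φ i).toAddMonoidHom) := fun i => h (φ i)
    let f : ((i : Fin k) → hatImage X (φ i).toAddMonoidHom) → G ⧸ X :=
      fun g => ∑ i, (g i : G ⧸ X)
    have hsub : (hatImage X γ : Set (G ⧸ X)) ⊆ Set.range f := by
      rintro _ ⟨_, ⟨x, hx, rfl⟩, rfl⟩
      refine ⟨fun i => ⟨QuotientAddGroup.mk' X (φ i x),
        ⟨φ i x, ⟨x, hx, rfl⟩, rfl⟩⟩, ?_⟩
      change ∑ i, QuotientAddGroup.mk' X (φ i x) = QuotientAddGroup.mk' X (γ x)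
      rw [hφ x, map_sum]
    exact ((Set.finite_range f).subset hsub).to_subtype
end

section
/- Let G be an abelian group with the property that every additive endomorphism of G is a finite sum of automorphisms of G. Then G has minimal full inertia if, and only if, G has minimal characteristic inertia. -/
theorem fullyInert_of_charInert {G : Type*} [AddCommGroup G]
    (hsum : ∀ γ : G →+ G, ∃ (k : ℕ) (φ : Fin k → (G ≃+ G)),
      ∀ x : G, γ x = ∑ i, (φ i) x) (X : AddSubgroup G) (hX : CharInertSub X) :
    FullyInertSub X := by
  intro γ
  obtain ⟨k, φ, h⟩ := hsum γ
  have hfin : ∀ i, Finite (hatImage X (φ i).toAddMonoidHom) := fun i => hX (φ i)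
  let f : (∀ i, hatImage X (φ i).toAddMonoidHom) → G ⧸ X := fun v => ∑ i, (v i : G ⧸ X)
  have hr : (Set.range f).Finite := Set.finite_range f
  refine (hr.subset ?_ : (hatImage X γ : Set (G ⧸ X)).Finite).to_subtype
  rintro _ ⟨_, ⟨x, hx, rfl⟩, rfl⟩
  refine ⟨fun i => ⟨QuotientAddGroup.mk' X (φ i x), ⟨φ i x, ⟨x, hx, rfl⟩, rfl⟩⟩, ?_⟩
  simp only [f]
  rw [h x, map_sum]

theorem fullyInvariant_of_characteristic {G : Type*} [AddCommGroup G]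
    (hsum : ∀ γ : G →+ G, ∃ (k : ℕ) (φ : Fin k → (G ≃+ G)),
      ∀ x : G, γ x = ∑ i, (φ i) x) (X : AddSubgroup G) (hX : CharacteristicSub X) :
    FullyInvariantSub X := by
  rintro γ _ ⟨x, hx, rfl⟩
  obtain ⟨k, φ, h⟩ := hsum γ
  rw [h x]
  exact sum_mem fun i _ => hX (φ i) ⟨x, hx, rfl⟩

/-- Corollary 2.3: if every endomorphism of `G` is a finite sum of automorphisms, then `G` has
minimal full inertia iff it has minimal characteristic inertia. -/
theorem stmt_3 {G : Type*} [AddCommGroup G]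
    (hsum : ∀ γ : G →+ G, ∃ (k : ℕ) (φ : Fin k → (G ≃+ G)),
      ∀ x : G, γ x = ∑ i, (φ i) x) :
    MinFullInertia G ↔ MinCharInertia G := by
  constructor
  · intro H X hX
    obtain ⟨Y, hY, hc⟩ := H X (fullyInert_of_charInert hsum X hX)
    exact ⟨Y, fun φ => hY φ.toAddMonoidHom, hc⟩
  · intro H X hX
    obtain ⟨Y, hY, hc⟩ := H X (fun φ => hX φ.toAddMonoidHom)
    exact ⟨Y, fullyInvariant_of_characteristic hsum Y hY, hc⟩
end

section
/- Let A be an abelian group and G = A ⊕ A (the direct product A × A). Then every additive endomorphism γ of G is the sum of four automorphisms of G: there exist automorphisms φ₁, φ₂, φ₃, φ₄ of G with γ(x) = φ₁(x) + φ₂(x) + φ₃(x) + φ₄(x) for all x ∈ G. -/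
/-- Lemma 2.6: every endomorphism of `G = A ⊕ A` is the sum of four automorphisms. -/
theorem stmt_4 {A : Type*} [AddCommGroup A] (γ : (A × A) →+ (A × A)) :
    ∃ φ₁ φ₂ φ₃ φ₄ : (A × A) ≃+ (A × A),
      ∀ x : A × A, γ x = φ₁ x + φ₂ x + φ₃ x + φ₄ x := by
  let a : A →+ A := (AddMonoidHom.fst A A).comp (γ.comp (AddMonoidHom.inl A A))
  let b : A →+ A := (AddMonoidHom.fst A A).comp (γ.comp (AddMonoidHom.inr A A))
  let c : A →+ A := (AddMonoidHom.snd A A).comp (γ.comp (AddMonoidHom.inl A A))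
  let d : A →+ A := (AddMonoidHom.snd A A).comp (γ.comp (AddMonoidHom.inr A A))
  have key : ∀ x y : A, γ (x, y) = (a x + b y, c x + d y) := by
    intro x y
    have h : ((x, y) : A × A) = (x, 0) + (0, y) := by simp
    rw [h, map_add]
    rfl
  clear_value a b c d
  refine ⟨
    { toFun := fun p => (p.1 + b p.2, p.2)
      invFun := fun p => (p.1 - b p.2, p.2)
      left_inv := fun p => by simp
      right_inv := fun p => by simp
      map_add' := fun p q => by ext <;> simp; abel },
    { toFun := fun p => (-p.1, c p.1 - p.2)
      invFun := fun p => (-p.1, -c p.1 - p.2)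
      left_inv := fun p => by ext <;> simp
      right_inv := fun p => by ext <;> simp
      map_add' := fun p q => by ext <;> simp <;> abel },
    { toFun := fun p => (a p.1 + p.2, p.1)
      invFun := fun p => (p.2, p.1 - a p.2)
      left_inv := fun p => by ext <;> simp
      right_inv := fun p => by ext <;> simp
      map_add' := fun p q => by ext <;> simp; abel },
    { toFun := fun p => (-p.2, d p.2 - p.1)
      invFun := fun p => (-d p.1 - p.2, -p.1)
      left_inv := fun p => by ext <;> simp
      right_inv := fun p => by ext <;> simp
      map_add' := fun p q => by ext <;> simp <;> abel }, ?_⟩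
  rintro ⟨x, y⟩
  rw [key]
  ext <;> simp <;> abel
end

section
/- Let p be a prime, A an abelian p-group, and G = A ⊕ A. Then the following are equivalent: (a) A has minimal full inertia; (b) G has minimal full inertia; (c) G has minimal characteristic inertia. -/
section Helpers

/-- `X` is contained in `Y` up to finite index. -/
def AlmLe {G : Type*} [AddCommGroup G] (X Y : AddSubgroup G) : Prop := Y.relIndex X ≠ 0

variable {G H A : Type*} [AddCommGroup G] [AddCommGroup H] [AddCommGroup A]

theorem AlmLe.of_le {X Y : AddSubgroup G} (h : X ≤ Y) : AlmLe X Y := by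
  unfold AlmLe
  rw [AddSubgroup.relIndex_eq_one.2 h]
  exact one_ne_zero

theorem AlmLe.trans {X Y Z : AddSubgroup G} (h : AlmLe X Y) (h' : AlmLe Y Z) : AlmLe X Z :=
  AddSubgroup.relIndex_ne_zero_trans h' h

theorem almLe_map {f : G →+ H} {X : AddSubgroup G} {Y : AddSubgroup H} :
    AlmLe (X.map f) Y ↔ AlmLe X (Y.comap f) := by
  unfold AlmLe
  rw [AddSubgroup.relIndex_comap]

theorem almLe_iff_finite {X Y : AddSubgroup G} :
    AlmLe X Y ↔ Finite (X.map (QuotientAddGroup.mk' Y)) := by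
  unfold AlmLe
  have h : Y = (⊥ : AddSubgroup (G ⧸ Y)).comap (QuotientAddGroup.mk' Y) := by
    rw [AddMonoidHom.comap_bot, QuotientAddGroup.ker_mk']
  conv_lhs => rw [h]
  rw [AddSubgroup.relIndex_comap, AddSubgroup.relIndex_bot_left]
  constructor
  · intro h
    exact Nat.finite_of_card_ne_zero h
  · intro h
    exact Nat.card_pos.ne'

theorem AlmLe.sup {X Y Z : AddSubgroup G} (h : AlmLe X Z) (h' : AlmLe Y Z) :
    AlmLe (X ⊔ Y) Z := by
  rw [almLe_iff_finite] at *
  rw [AddSubgroup.map_sup]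
  have h1 := Set.Finite.add (Set.toFinite (X.map (QuotientAddGroup.mk' Z) : Set (G ⧸ Z)))
    (Set.toFinite (Y.map (QuotientAddGroup.mk' Z) : Set (G ⧸ Z)))
  refine Set.Finite.subset h1 ?_
  intro z hz
  obtain ⟨x, hx, y, hy, rfl⟩ := AddSubgroup.mem_sup.1 hz
  exact Set.add_mem_add hx hy

theorem commens_iff {X Y : AddSubgroup G} : Commens X Y ↔ AlmLe X Y ∧ AlmLe Y X := by
  unfold Commens AlmLe
  change (X ⊓ Y).relIndex X ≠ 0 ∧ (X ⊓ Y).relIndex Y ≠ 0 ↔ _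
  rw [AddSubgroup.inf_relIndex_left, AddSubgroup.inf_relIndex_right]

theorem finite_hat {X : AddSubgroup G} {φ : G →+ G} :
    Finite (hatImage X φ) ↔ AlmLe (X.map φ) X := almLe_iff_finite.symm

/-- Every endomorphism of `A × A` is a sum of differences of automorphisms. -/
theorem end_induction (P : (A × A →+ A × A) → Prop)
    (hu : ∀ φ : A × A ≃+ A × A, P φ.toAddMonoidHom)
    (hadd : ∀ f g, P f → P g → P (f + g)) (hneg : ∀ f, P f → P (-f)) (f) : P f := by
  let U (b : A →+ A) : A × A ≃+ A × A :=
    { toFun := fun x => (x.1 + b x.2, x.2)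
      invFun := fun x => (x.1 - b x.2, x.2)
      left_inv := fun x => by simp
      right_inv := fun x => by simp
      map_add' := fun x y => by ext <;> simp; abel }
  let L (b : A →+ A) : A × A ≃+ A × A :=
    { toFun := fun x => (x.1, x.2 + b x.1)
      invFun := fun x => (x.1, x.2 - b x.1)
      left_inv := fun x => by simp
      right_inv := fun x => by simp
      map_add' := fun x y => by ext <;> simp; abel }
  let M (b : A →+ A) : A × A ≃+ A × A :=
    { toFun := fun x => (b x.1 + x.2, x.1)
      invFun := fun x => (x.2, x.1 - b x.2)
      left_inv := fun x => by simp
      right_inv := fun x => by simp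
      map_add' := fun x y => by ext <;> simp; abel }
  let N (b : A →+ A) : A × A ≃+ A × A :=
    { toFun := fun x => (x.2, x.1 + b x.2)
      invFun := fun x => (x.2 - b x.1, x.1)
      left_inv := fun x => by simp
      right_inv := fun x => by simp
      map_add' := fun x y => by ext <;> simp; abel }
  let i1 := AddMonoidHom.inl A A
  let i2 := AddMonoidHom.inr A A
  let p1 := AddMonoidHom.fst A A
  let p2 := AddMonoidHom.snd A A
  have key : f =
      (((U (p1.comp (f.comp i2))).toAddMonoidHom + -(U 0).toAddMonoidHom) +
      ((L (p2.comp (f.comp i1))).toAddMonoidHom + -(L 0).toAddMonoidHom)) +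
      (((M (p1.comp (f.comp i1))).toAddMonoidHom + -(M 0).toAddMonoidHom) +
      ((N (p2.comp (f.comp i2))).toAddMonoidHom + -(N 0).toAddMonoidHom)) := by
    refine AddMonoidHom.ext fun x => ?_
    have hx : f x = f (x.1, 0) + f (0, x.2) := by rw [← map_add]; simp
    rw [hx]
    ext <;> simp [U, L, M, N, i1, i2, p1, p2] <;> abel
  rw [key]
  have h2 : ∀ u v : A × A ≃+ A × A, P (u.toAddMonoidHom + -v.toAddMonoidHom) :=
    fun u v => hadd _ _ (hu u) (hneg _ (hu v))
  exact hadd _ _ (hadd _ _ (h2 _ _) (h2 _ _)) (hadd _ _ (h2 _ _) (h2 _ _))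

theorem map_add_le (X : AddSubgroup G) (f g : G →+ H) :
    X.map (f + g) ≤ X.map f ⊔ X.map g := by
  rintro _ ⟨x, hx, rfl⟩
  exact AddSubgroup.mem_sup.2 ⟨f x, ⟨x, hx, rfl⟩, g x, ⟨x, hx, rfl⟩, rfl⟩

theorem map_neg_le (X : AddSubgroup G) (f : G →+ H) : X.map (-f) ≤ X.map f := by
  rintro _ ⟨x, hx, rfl⟩
  exact ⟨-x, X.neg_mem hx, by simp⟩

theorem charInert_iff {X : AddSubgroup (A × A)} : CharInertSub X ↔ FullyInertSub X := by
  refine ⟨fun h φ => ?_, fun h φ => h _⟩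
  refine end_induction (fun φ => Finite (hatImage X φ)) h ?_ ?_ φ
  · intro f g hf hg
    rw [finite_hat] at *
    exact (AlmLe.of_le (map_add_le X f g)).trans (hf.sup hg)
  · intro f hf
    rw [finite_hat] at *
    exact (AlmLe.of_le (map_neg_le X f)).trans hf

theorem charac_iff {X : AddSubgroup (A × A)} : CharacteristicSub X ↔ FullyInvariantSub X := by
  refine ⟨fun h φ => ?_, fun h φ => h _⟩
  refine end_induction (fun φ => X.map φ ≤ X) h ?_ ?_ φ
  · intro f g hf hg
    exact (map_add_le X f g).trans (sup_le hf hg)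
  · intro f hf
    exact (map_neg_le X f).trans hf

theorem le_sup_prod (X : AddSubgroup (A × A)) :
    X ≤ (X.map (AddMonoidHom.fst A A)).map (AddMonoidHom.inl A A) ⊔
      (X.map (AddMonoidHom.snd A A)).map (AddMonoidHom.inr A A) := by
  intro x hx
  exact AddSubgroup.mem_sup.2 ⟨(x.1, 0), ⟨x.1, ⟨x, hx, rfl⟩, rfl⟩,
    (0, x.2), ⟨x.2, ⟨x, hx, rfl⟩, rfl⟩, by simp⟩

theorem comap_inl_prod (X Y : AddSubgroup A) :
    (X.prod Y).comap (AddMonoidHom.inl A A) = X := by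
  ext x; simp [AddSubgroup.mem_prod, Y.zero_mem]

theorem comap_inr_prod (X Y : AddSubgroup A) :
    (X.prod Y).comap (AddMonoidHom.inr A A) = Y := by
  ext x; simp [AddSubgroup.mem_prod, X.zero_mem]

/-- A subgroup with almost contained coordinates is almost contained in the product. -/
theorem almLe_prod {X : AddSubgroup (A × A)} {Y : AddSubgroup A}
    (h1 : AlmLe (X.map (AddMonoidHom.fst A A)) Y)
    (h2 : AlmLe (X.map (AddMonoidHom.snd A A)) Y) : AlmLe X (Y.prod Y) := by
  refine (AlmLe.of_le (le_sup_prod X)).trans (AlmLe.sup ?_ ?_)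
  · rw [almLe_map, comap_inl_prod]; exact h1
  · rw [almLe_map, comap_inr_prod]; exact h2

theorem map_fst_prod_le (X Y : AddSubgroup A) : (X.prod Y).map (AddMonoidHom.fst A A) ≤ X := by
  rintro _ ⟨x, hx, rfl⟩
  exact hx.1

theorem map_snd_prod_le (X Y : AddSubgroup A) : (X.prod Y).map (AddMonoidHom.snd A A) ≤ Y := by
  rintro _ ⟨x, hx, rfl⟩
  exact hx.2

/-- An almost inclusion out of a product can be checked on the factors. -/
theorem prod_almLe {X Y : AddSubgroup A} {Z : AddSubgroup (A × A)}
    (h1 : AlmLe (X.map (AddMonoidHom.inl A A)) Z)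
    (h2 : AlmLe (Y.map (AddMonoidHom.inr A A)) Z) : AlmLe (X.prod Y) Z :=
  (AlmLe.of_le ((le_sup_prod _).trans (sup_le_sup
    (AddSubgroup.map_mono (map_fst_prod_le X Y))
    (AddSubgroup.map_mono (map_snd_prod_le X Y))))).trans (h1.sup h2)

theorem prod_mono_almLe {X Y : AddSubgroup A} (h : AlmLe X Y) :
    AlmLe (X.prod X) (Y.prod Y) :=
  almLe_prod ((AlmLe.of_le (map_fst_prod_le X X)).trans h)
    ((AlmLe.of_le (map_snd_prod_le X X)).trans h)

theorem fullyInert_iff {X : AddSubgroup G} :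
    FullyInertSub X ↔ ∀ φ : G →+ G, AlmLe (X.map φ) X :=
  forall_congr' fun _ => finite_hat

theorem a_to_b (h : MinFullInertia A) : MinFullInertia (A × A) := by
  intro X hX
  rw [fullyInert_iff] at hX
  let i1 := AddMonoidHom.inl A A
  let i2 := AddMonoidHom.inr A A
  let p1 := AddMonoidHom.fst A A
  let p2 := AddMonoidHom.snd A A
  let X1 := X.comap i1
  have hle : X1.map i1 ≤ X := AddSubgroup.map_comap_le _ _
  have e1 : AlmLe (X.map p1) X1 := by
    rw [← almLe_map, AddSubgroup.map_map]; exact hX _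
  have e2 : AlmLe (X.map p2) X1 := by
    rw [← almLe_map, AddSubgroup.map_map]; exact hX _
  have hXP : AlmLe X (X1.prod X1) := almLe_prod e1 e2
  have hPX : AlmLe (X1.prod X1) X := by
    refine prod_almLe (AlmLe.of_le hle) ((AlmLe.of_le ?_).trans (hX (i2.comp p1)))
    rintro _ ⟨x, hx, rfl⟩
    exact ⟨(x, 0), hx, rfl⟩
  have hX1 : FullyInertSub X1 := by
    rw [fullyInert_iff]
    intro f
    rw [← almLe_map]
    refine (AlmLe.of_le ?_).trans (hX (i1.comp (f.comp p1)))
    rintro _ ⟨_, ⟨x, hx, rfl⟩, rfl⟩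
    exact ⟨(x, 0), hx, rfl⟩
  obtain ⟨Y, hY, hc⟩ := h X1 hX1
  rw [commens_iff] at hc
  refine ⟨Y.prod Y, ?_, commens_iff.2
    ⟨hXP.trans (prod_mono_almLe hc.1), (prod_mono_almLe hc.2).trans hPX⟩⟩
  intro φ
  rintro _ ⟨x, hx, rfl⟩
  have hs : φ x = φ (x.1, 0) + φ (0, x.2) := by rw [← map_add]; simp
  rw [hs]
  have h1 : ∀ g : A →+ A, ∀ y ∈ Y, g y ∈ Y := fun g y hy => hY g ⟨y, hy, rfl⟩
  exact ⟨Y.add_mem (h1 (p1.comp (φ.comp i1)) _ hx.1) (h1 (p1.comp (φ.comp i2)) _ hx.2),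
    Y.add_mem (h1 (p2.comp (φ.comp i1)) _ hx.1) (h1 (p2.comp (φ.comp i2)) _ hx.2)⟩

theorem b_to_a (h : MinFullInertia (A × A)) : MinFullInertia A := by
  intro X hX
  rw [fullyInert_iff] at hX
  let i1 := AddMonoidHom.inl A A
  let i2 := AddMonoidHom.inr A A
  let p1 := AddMonoidHom.fst A A
  let p2 := AddMonoidHom.snd A A
  have hP : FullyInertSub (X.prod X) := by
    rw [fullyInert_iff]
    intro φ
    rw [almLe_map]
    refine prod_almLe ?_ ?_
    · rw [← almLe_map]
      refine almLe_prod ?_ ?_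
      · rw [AddSubgroup.map_map, AddSubgroup.map_map]; exact hX _
      · rw [AddSubgroup.map_map, AddSubgroup.map_map]; exact hX _
    · rw [← almLe_map]
      refine almLe_prod ?_ ?_
      · rw [AddSubgroup.map_map, AddSubgroup.map_map]; exact hX _
      · rw [AddSubgroup.map_map, AddSubgroup.map_map]; exact hX _
  obtain ⟨Y, hY, hc⟩ := h _ hP
  rw [commens_iff] at hc
  refine ⟨Y.comap i1, ?_, commens_iff.2 ⟨?_, ?_⟩⟩
  · rintro f _ ⟨x, hx, rfl⟩
    exact hY (i1.comp (f.comp p1)) ⟨(x, 0), hx, rfl⟩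
  · rw [← almLe_map]
    refine (AlmLe.of_le ?_).trans hc.1
    rintro _ ⟨x, hx, rfl⟩
    exact ⟨hx, X.zero_mem⟩
  · have h2 : AlmLe ((Y.comap i1).map i1) (X.prod X) :=
      (AlmLe.of_le (AddSubgroup.map_comap_le _ _)).trans hc.2
    rwa [almLe_map, comap_inl_prod] at h2

end Helpers

theorem stmt_5 {A : Type*} [AddCommGroup A] (p : ℕ) (hp : p.Prime) (hA : IsPGroup' p A) :
    (MinFullInertia A ↔ MinFullInertia (A × A)) ∧
      (MinFullInertia (A × A) ↔ MinCharInertia (A × A)) := by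
  refine ⟨⟨a_to_b, b_to_a⟩, ?_⟩
  unfold MinFullInertia MinCharInertia
  simp only [charInert_iff, charac_iff]
end

section
/- Let p be an odd prime and G a transitive abelian p-group. Then every characteristic subgroup of G is fully invariant. -/
section Helpers

variable {G : Type*} [AddCommGroup G]

theorem mem_D {p n : ℕ} {x : G} :
    x ∈ (pPowSub p n : AddSubgroup G) ↔ ∃ u : G, p ^ n • u = x := by
  simp [pPowSub, smulHom]

theorem D_anti {p m n : ℕ} (h : m ≤ n) {x : G} (hx : x ∈ (pPowSub p n : AddSubgroup G)) :
    x ∈ (pPowSub p m : AddSubgroup G) := by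
  obtain ⟨u, rfl⟩ := mem_D.1 hx
  refine mem_D.2 ⟨p ^ (n - m) • u, ?_⟩
  rw [← mul_smul, ← pow_add]
  congr 2
  omega

theorem D_shift {p i n : ℕ} (k : ℕ) {x : G} (hx : p ^ i • x ∈ (pPowSub p n : AddSubgroup G)) :
    p ^ (i + k) • x ∈ (pPowSub p (n + k) : AddSubgroup G) := by
  obtain ⟨u, hu⟩ := mem_D.1 hx
  refine mem_D.2 ⟨u, ?_⟩
  rw [add_comm n, add_comm i, pow_add, mul_smul, hu, ← mul_smul, ← pow_add]

theorem D_zero {p : ℕ} (x : G) : x ∈ (pPowSub p 0 : AddSubgroup G) :=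
  mem_D.2 ⟨x, by simp⟩

/-- heights of multiples of `y` dominate those of `x` -/
def Dom (p : ℕ) (x y : G) : Prop :=
  ∀ i n : ℕ, p ^ i • x ∈ (pPowSub p n : AddSubgroup G) → p ^ i • y ∈ (pPowSub p n : AddSubgroup G)

/-- strict domination at index `i` -/
def Str (p : ℕ) (x y : G) (i : ℕ) : Prop :=
  ∀ n : ℕ, p ^ i • x ∈ (pPowSub p n : AddSubgroup G) →
    p ^ i • y ∈ (pPowSub p (n + 1) : AddSubgroup G)

theorem Str.back {p : ℕ} {x y : G} {i : ℕ} (h : Str p x y i) (n : ℕ)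
    (hn : p ^ i • (x + y) ∈ (pPowSub p n : AddSubgroup G)) :
    p ^ i • x ∈ (pPowSub p n : AddSubgroup G) := by
  induction n with
  | zero => exact D_zero _
  | succ n ih =>
    have h1 := h n (ih (D_anti (Nat.le_succ n) hn))
    have h2 := AddSubgroup.sub_mem _ hn h1
    rwa [smul_add, add_sub_cancel_right] at h2

theorem mem_of_back {p : ℕ} (htrans : TransitiveP p G) {X : AddSubgroup G}
    (hX : CharacteristicSub X) {x y : G} (hx : x ∈ X) (hd : Dom p x y)
    (hb : ∀ i n : ℕ, p ^ i • (x + y) ∈ (pPowSub p n : AddSubgroup G) →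
      p ^ i • x ∈ (pPowSub p n : AddSubgroup G)) : y ∈ X := by
  have key : ∀ i n : ℕ, p ^ i • x ∈ (pPowSub p n : AddSubgroup G) ↔
      p ^ i • (x + y) ∈ (pPowSub p n : AddSubgroup G) := by
    intro i n
    refine ⟨fun h => ?_, hb i n⟩
    rw [smul_add]
    exact AddSubgroup.add_mem _ h (hd i n h)
  obtain ⟨φ, hφ⟩ := htrans x (x + y) (by
    intro i
    unfold pHeight
    simp only [Set.mem_setOf_eq, key])
  have h1 : x + y ∈ X := by
    rw [← hφ]
    exact hX φ (AddSubgroup.mem_map.2 ⟨x, hx, rfl⟩)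
  have h2 := AddSubgroup.sub_mem _ h1 hx
  rwa [add_sub_cancel_left] at h2

theorem main_ind {p : ℕ} (hp : Odd p) (htrans : TransitiveP p G) {X : AddSubgroup G}
    (hX : CharacteristicSub X) {x : G} (hx : x ∈ X) {N : ℕ} (hN : p ^ N • x = 0) :
    ∀ k m : ℕ, N ≤ m + k → ∀ v : G, Dom p x v → (∀ i < m, Str p x v i) → v ∈ X := by
  have hN' : ∀ i, N ≤ i → p ^ i • x = 0 := by
    intro i hi
    obtain ⟨c, rfl⟩ := Nat.exists_eq_add_of_le hi
    rw [add_comm, pow_add, mul_smul, hN, smul_zero]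
  intro k
  induction k with
  | zero =>
    intro m hm v hd hs
    refine mem_of_back htrans hX hx hd (fun i n h => ?_)
    by_cases hi : i < m
    · exact (hs i hi).back n h
    · rw [hN' i (by omega)]
      exact AddSubgroup.zero_mem _
  | succ k ih =>
    intro m hm v hd hs
    by_cases hsm : Str p x v m
    · refine ih (m + 1) (by omega) v hd (fun i hi => ?_)
      rcases Nat.lt_succ_iff_lt_or_eq.1 hi with h | h
      · exact hs i h
      · rw [h]; exact hsm
    unfold Str at hsm
    push Not at hsm
    obtain ⟨n0, h0, hv0⟩ := hsm
    have hx0 : p ^ m • x ∉ (pPowSub p (n0 + 1) : AddSubgroup G) := fun h => hv0 (hd _ _ h)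
    have hex : ∃ j, p ^ (m + j + 1) • x ∈ (pPowSub p (n0 + j + 2) : AddSubgroup G) := by
      refine ⟨N, ?_⟩
      rw [hN' _ (by omega)]
      exact AddSubgroup.zero_mem _
    classical
    obtain ⟨j, hj, hmin⟩ : ∃ j, p ^ (m + j + 1) • x ∈ (pPowSub p (n0 + j + 2) : AddSubgroup G) ∧
        ∀ i < j, p ^ (m + i + 1) • x ∉ (pPowSub p (n0 + i + 2) : AddSubgroup G) :=
      ⟨Nat.find hex, Nat.find_spec hex, fun i hi => Nat.find_min hex hi⟩
    have hnot : ∀ i ≤ j, p ^ (m + i) • x ∉ (pPowSub p (n0 + i + 1) : AddSubgroup G) := by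
      intro i hi
      cases i with
      | zero => exact hx0
      | succ i => exact hmin i (by omega)
    have hmn : m ≤ n0 := by
      by_contra hlt
      exact hx0 (D_anti (by omega) (mem_D.2 ⟨x, rfl⟩ : p ^ m • x ∈ (pPowSub p m : AddSubgroup G)))
    obtain ⟨u, hu⟩ := mem_D.1 (hd _ _ hj)
    obtain ⟨c, rfl⟩ := Nat.exists_eq_add_of_le hmn
    -- w = p^(c+1) u
    obtain ⟨w, hw⟩ : ∃ w, w = p ^ (c + 1) • u := ⟨_, rfl⟩
    have hwi : ∀ i, p ^ i • w = p ^ (c + 1 + i) • u := by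
      intro i
      rw [hw, ← mul_smul, ← pow_add, add_comm]
    have hwv : ∀ i, m + j < i → p ^ i • w = p ^ i • v := by
      intro i hi
      obtain ⟨d, rfl⟩ := Nat.exists_eq_add_of_lt hi
      rw [hwi, show c + 1 + (m + j + d + 1) = d + (m + c + j + 2) by omega, pow_add, mul_smul, hu,
        ← mul_smul, ← pow_add]
      congr 2
      omega
    have hws : ∀ i < m + j + 1, Str p x w i := by
      intro i hi n hn
      obtain ⟨d, hd'⟩ := Nat.exists_eq_add_of_le (Nat.lt_succ_iff.1 hi)
      have h1 := D_shift d hn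
      rw [← hd'] at h1
      have h2 : n + d < m + c + j + 1 := by
        by_contra hge
        exact hnot j le_rfl (D_anti (by omega) h1)
      rw [hwi]
      exact D_anti (n := c + 1 + i) (by omega) (mem_D.2 ⟨u, rfl⟩)
    have hwd : Dom p x w := by
      intro i n hn
      by_cases hi : i < m + j + 1
      · exact D_anti (Nat.le_succ n) (hws i hi n hn)
      · rw [hwv i (by omega)]
        exact hd i n hn
    have hwX : w ∈ X := ih (m + j + 1) (by omega) w hwd hws
    -- the elements z = ± (v - w)
    have main : ∀ z : G, Dom p x z → (∀ i < m, Str p x z i) →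
        (∀ i, m + j < i → p ^ i • z = 0) →
        p ^ (m + j) • (x + z) ∉ (pPowSub p (m + c + j + 1) : AddSubgroup G) → z ∈ X := by
      intro z hzd hzs hz0 hzn
      refine mem_of_back htrans hX hx hzd (fun i n h => ?_)
      by_cases hi : i < m
      · exact (hzs i hi).back n h
      by_cases hi2 : m + j < i
      · rwa [smul_add, hz0 i hi2, add_zero] at h
      obtain ⟨e, rfl⟩ := Nat.exists_eq_add_of_le (not_lt.1 hi)
      by_cases hn : n ≤ m + c + e
      · exact D_anti hn (D_shift e h0)
      · exfalso
        obtain ⟨f, rfl⟩ := Nat.exists_eq_add_of_le (show e ≤ j by omega)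
        apply hzn
        have := D_shift f h
        rw [add_assoc] at this
        exact D_anti (by omega) this
    have hyd : Dom p x (v - w) := by
      intro i n hn
      rw [smul_sub]
      exact AddSubgroup.sub_mem _ (hd i n hn) (hwd i n hn)
    have hys : ∀ i < m, Str p x (v - w) i := by
      intro i hi n hn
      rw [smul_sub]
      exact AddSubgroup.sub_mem _ (hs i hi n hn) (hws i (by omega) n hn)
    have hy0 : ∀ i, m + j < i → p ^ i • (v - w) = 0 := by
      intro i hi
      rw [smul_sub, hwv i hi, sub_self]
    have hyX : v - w ∈ X := by
      by_cases h1 : p ^ (m + j) • (x + (v - w)) ∈ (pPowSub p (m + c + j + 1) : AddSubgroup G)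
      · have h2 : p ^ (m + j) • (x + -(v - w)) ∉ (pPowSub p (m + c + j + 1) : AddSubgroup G) := by
          intro h2
          apply hnot j le_rfl
          have h3 := AddSubgroup.add_mem _ h1 h2
          rw [← smul_add, show x + (v - w) + (x + -(v - w)) = 2 • x by abel] at h3
          obtain ⟨t, ht⟩ := (hp.pow (n := N))
          have h4 := AddSubgroup.nsmul_mem _ h3 (t + 1)
          have h5 : (t + 1) • p ^ (m + j) • 2 • x = p ^ (m + j) • x := by
            have : (t + 1) • p ^ (m + j) • 2 • x = p ^ (m + j) • ((p ^ N) • x + x) := by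
              rw [ht, ← succ_nsmul, ← mul_smul, ← mul_smul, ← mul_smul]
              congr 1
              ring
            rw [this, hN, zero_add]
          rwa [h5] at h4
        have h6 := main (-(v - w))
          (fun i n hn => by rw [smul_neg]; exact AddSubgroup.neg_mem _ (hyd i n hn))
          (fun i hi n hn => by rw [smul_neg]; exact AddSubgroup.neg_mem _ (hys i hi n hn))
          (fun i hi => by rw [smul_neg, hy0 i hi, neg_zero]) h2
        exact (AddSubgroup.neg_mem_iff _).1 h6
      · exact main _ hyd hys hy0 h1
    have := AddSubgroup.add_mem _ hyX hwX
    rwa [sub_add_cancel] at this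

end Helpers

/-- For an odd prime `p` and a transitive `p`-group `G`, every characteristic subgroup of `G`
is fully invariant. -/
theorem stmt_7 {G : Type*} [AddCommGroup G] (p : ℕ) (hp : p.Prime) (hodd : p ≠ 2)
    (hG : IsPGroup' p G) (htrans : TransitiveP p G)
    (X : AddSubgroup G) (hX : CharacteristicSub X) :
    FullyInvariantSub X := by
  intro φ y hy
  obtain ⟨x, hx, rfl⟩ := AddSubgroup.mem_map.1 hy
  obtain ⟨N, hN⟩ := hG x
  refine main_ind (hp.odd_of_ne_two hodd) htrans hX hx hN N 0 (by omega) (φ x) ?_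
    (fun i hi => absurd hi (Nat.not_lt_zero i))
  intro i n h
  obtain ⟨u, hu⟩ := mem_D.1 h
  exact mem_D.2 ⟨φ u, by rw [← map_nsmul, hu, map_nsmul]⟩
end

section
/- Let p be an odd prime and G a separable abelian p-group (i.e., the intersection ⋂ₙ pⁿG of all the subgroups pⁿG is zero). If G has minimal characteristic inertia, then G has minimal full inertia. -/
/-- Projection onto a cyclic summand. -/
theorem aux_proj {G : Type*} [AddCommGroup G] (p : ℕ) (hp : p.Prime) (c : G) (h : ℕ)
    (hc : p ^ (h + 1) • c = 0) (hn : p ^ h • c ∉ (pPowSub p (h + 1) : AddSubgroup G)) :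
    ∃ e : G →+ G, e c = c ∧ ∀ g, ∃ k : ℤ, e g = k • c := by
  have hN : 0 < p ^ (h + 1) := pow_pos hp.pos _
  have hne : (QuotientAddGroup.mk' (pPowSub p (h + 1) : AddSubgroup G)) (p ^ h • c) ≠ 0 := by
    intro h0
    exact hn ((QuotientAddGroup.eq_zero_iff _).1 h0)
  obtain ⟨χ', hχ'⟩ := CharacterModule.exists_character_apply_ne_zero_of_ne_zero hne
  obtain ⟨χ, hχ⟩ : ∃ χ : G →+ AddCircle (1 : ℚ), ∀ g, χ g = χ' (QuotientAddGroup.mk' _ g) :=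
    ⟨AddMonoidHom.comp (χ' : (G ⧸ (pPowSub p (h + 1) : AddSubgroup G)) →+ AddCircle (1 : ℚ))
      (QuotientAddGroup.mk' _), fun g => rfl⟩
  have hkill : ∀ g, p ^ (h + 1) • χ g = 0 := by
    intro g
    rw [← map_nsmul, hχ]
    have : QuotientAddGroup.mk' (pPowSub p (h + 1) : AddSubgroup G) (p ^ (h + 1) • g) = 0 :=
      (QuotientAddGroup.eq_zero_iff _).2 ⟨g, trivial, rfl⟩
    rw [this]
    exact map_zero χ'
  have hχc : χ (p ^ h • c) ≠ 0 := by rw [hχ]; exact hχ'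
  set u : AddCircle (1 : ℚ) := (((1 : ℚ) / ((p ^ (h + 1) : ℕ) : ℚ) : ℚ) : AddCircle (1 : ℚ)) with hu
  have : Fact ((0 : ℚ) < 1) := ⟨one_pos⟩
  have huord : addOrderOf u = p ^ (h + 1) := AddCircle.addOrderOf_period_div hN
  have hu0 : ∀ k : ℤ, k • u = 0 ↔ ((p ^ (h + 1) : ℕ) : ℤ) ∣ k := by
    intro k
    rw [← huord, addOrderOf_dvd_iff_zsmul_eq_zero]
  have hgen : ∀ w : AddCircle (1 : ℚ), p ^ (h + 1) • w = 0 → ∃ m : ℤ, w = m • u := by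
    intro w hw
    induction w using QuotientAddGroup.induction_on with
    | H q =>
      have hw' : (((p ^ (h + 1) : ℕ) • q : ℚ) : AddCircle (1 : ℚ)) = 0 := hw
      rw [AddCircle.coe_eq_zero_iff] at hw'
      obtain ⟨m, hm⟩ := hw'
      refine ⟨m, ?_⟩
      rw [hu, ← AddCircle.coe_zsmul]
      congr 1
      have : ((p ^ (h + 1) : ℕ) : ℚ) ≠ 0 := by exact_mod_cast hN.ne'
      simp only [zsmul_eq_mul, nsmul_eq_mul, mul_one] at hm ⊢
      rw [hm]; field_simp
  obtain ⟨m0, hm0⟩ := hgen (χ c) (hkill c)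
  have hpm : ¬ (p : ℤ) ∣ m0 := by
    rintro ⟨r, rfl⟩
    apply hχc
    rw [map_nsmul, hm0, ← natCast_zsmul, smul_smul, hu0]
    exact ⟨r, by push_cast; ring⟩
  have hcop : IsCoprime m0 ((p ^ (h + 1) : ℕ) : ℤ) := by
    push_cast
    exact (((Nat.prime_iff_prime_int.1 hp).coprime_iff_not_dvd.2 hpm).symm).pow_right
  obtain ⟨a, b, hab⟩ := hcop
  have hex : ∀ g, ∃ k : ℤ, χ g = k • χ c := by
    intro g
    obtain ⟨m, hm⟩ := hgen (χ g) (hkill g)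
    refine ⟨m * a, ?_⟩
    rw [hm, hm0, smul_smul, ← sub_eq_zero, ← sub_smul, hu0]
    exact ⟨m * b, by linear_combination (-m) * hab⟩
  have hwd : ∀ k l : ℤ, k • χ c = l • χ c → k • c = l • c := by
    intro k l hkl
    rw [← sub_eq_zero, ← sub_smul] at hkl ⊢
    rw [hm0, smul_smul, hu0] at hkl
    obtain ⟨d, hd⟩ := IsCoprime.dvd_of_dvd_mul_right (⟨b, a, by linear_combination hab⟩) hkl
    rw [hd, mul_comm, mul_smul, natCast_zsmul, hc, smul_zero]
  choose k hk using hex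
  refine ⟨AddMonoidHom.mk' (fun g => k g • c) ?_, ?_, fun g => ⟨k g, rfl⟩⟩
  · intro x y
    rw [← add_smul]
    apply hwd
    rw [← hk, map_add, hk x, hk y, add_smul]
  · change k c • c = c
    conv_rhs => rw [← one_smul ℤ c]
    apply hwd
    rw [← hk, one_smul]

theorem aux_sqzero {G : Type*} [AddCommGroup G] (Y : AddSubgroup G) (hY : CharacteristicSub Y)
    (f : G →+ G) (hf : ∀ x, f (f x) = 0) (x : G) (hx : x ∈ Y) : f x ∈ Y := by
  let φ : G ≃+ G :=
    { toFun := fun x => x + f x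
      invFun := fun x => x - f x
      left_inv := fun x => by simp [hf]
      right_inv := fun x => by simp [hf]
      map_add' := fun x y => by simp only [map_add]; abel }
  have h1 : x + f x ∈ Y := hY φ ⟨x, hx, rfl⟩
  simpa using Y.sub_mem h1 hx

theorem aux_idem {G : Type*} [AddCommGroup G] (p : ℕ) (hp : p.Prime) (hodd : p ≠ 2)
    (hG : IsPGroup' p G) (Y : AddSubgroup G) (hY : CharacteristicSub Y)
    (e : G →+ G) (he : ∀ x, e (e x) = e x) (x : G) (hx : x ∈ Y) : e x ∈ Y := by
  have hinv : ∀ x, (x - (e x + e x)) - (e (x - (e x + e x)) + e (x - (e x + e x))) = x := by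
    intro x
    simp only [map_sub, map_add, he]; abel
  let φ : G ≃+ G :=
    { toFun := fun x => x - (e x + e x)
      invFun := fun x => x - (e x + e x)
      left_inv := hinv
      right_inv := hinv
      map_add' := fun x y => by simp only [map_add]; abel }
  have h1 : x - (e x + e x) ∈ Y := hY φ ⟨x, hx, rfl⟩
  have h2 : e x + e x ∈ Y := by simpa using Y.sub_mem hx h1
  obtain ⟨n, hn⟩ := hG (e x)
  have hop : Odd (p ^ n) := (hp.odd_of_ne_two hodd).pow
  obtain ⟨t, ht⟩ := hop
  have h3 : e x = -(t • (e x + e x)) := by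
    rw [ht, add_smul, one_smul, mul_comm, mul_smul, two_smul] at hn
    exact eq_neg_of_add_eq_zero_right hn
  rw [h3]
  exact Y.neg_mem (Y.nsmul_mem h2 t)

theorem aux_fi {G : Type*} [AddCommGroup G] (p : ℕ) (hp : p.Prime) (hodd : p ≠ 2)
    (hG : IsPGroup' p G) (hsep : SeparableP p G) (Y : AddSubgroup G) (hY : CharacteristicSub Y)
    (φ : G →+ G) : ∀ (n : ℕ) (x : G), x ∈ Y → p ^ n • x = 0 → φ x ∈ Y := by
  intro n
  induction n with
  | zero =>
    intro x _ h
    have : x = 0 := by simpa using h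
    rw [this, map_zero]; exact Y.zero_mem
  | succ n ih =>
    intro x hx hxn
    by_cases hz : p ^ n • x = 0
    · exact ih x hx hz
    have hex : ∃ N, p ^ n • x ∉ (pPowSub p N : AddSubgroup G) := by
      by_contra! hcon
      apply hz
      have : p ^ n • x ∈ (⨅ n : ℕ, (pPowSub p n : AddSubgroup G)) := AddSubgroup.mem_iInf.2 hcon
      rw [hsep] at this
      exact this
    classical
    obtain ⟨h, hh1, hh2⟩ : ∃ h, p ^ n • x ∈ (pPowSub p h : AddSubgroup G) ∧
        p ^ n • x ∉ (pPowSub p (h + 1) : AddSubgroup G) := by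
      have h0 : Nat.find hex ≠ 0 := by
        intro h0
        have := Nat.find_spec hex
        rw [h0] at this
        exact this ⟨p ^ n • x, trivial, by simp [smulHom]⟩
      obtain ⟨h, hh⟩ := Nat.exists_eq_succ_of_ne_zero h0
      refine ⟨h, ?_, ?_⟩
      · by_contra hcon
        exact Nat.find_min hex (by omega) hcon
      · have := Nat.find_spec hex
        rwa [hh] at this
    obtain ⟨c, -, hc'⟩ := hh1
    have hc : p ^ h • c = p ^ n • x := hc'
    have hc0 : p ^ (h + 1) • c = 0 := by
      rw [pow_succ', mul_smul, hc, ← mul_smul, ← pow_succ', hxn]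
    obtain ⟨e, hec, heg⟩ := aux_proj p hp c h hc0 (by rw [hc]; exact hh2)
    have he : ∀ x, e (e x) = e x := by
      intro x
      obtain ⟨k, hk⟩ := heg x
      rw [hk, map_zsmul, hec]
    have hex' : e x ∈ Y := aux_idem p hp hodd hG Y hY e he x hx
    have h1 : φ (x - e x) ∈ Y := by
      apply ih _ (Y.sub_mem hx hex')
      rw [smul_sub, ← map_nsmul, ← hc, map_nsmul, hec, sub_self]
    have h2 : φ (e x) - e (φ (e x)) ∈ Y := by
      let f : G →+ G := (φ.comp e) - (e.comp (φ.comp e))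
      have hfx : ∀ x, f x = φ (e x) - e (φ (e x)) := fun x => rfl
      rw [← hfx]
      apply aux_sqzero Y hY f _ x hx
      intro y
      have : e (f y) = 0 := by rw [hfx, map_sub, he, sub_self]
      rw [hfx (f y), this]; simp
    have h3 : e (φ (e x)) ∈ Y := by
      obtain ⟨k, hk⟩ := heg x
      obtain ⟨l, hl⟩ := heg (φ c)
      have : e (φ (e x)) = l • e x := by
        rw [hk, map_zsmul, map_zsmul, hl, smul_comm]
      rw [this]; exact Y.zsmul_mem hex' l
    have : φ x = φ (x - e x) + ((φ (e x) - e (φ (e x))) + e (φ (e x))) := by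
      rw [map_sub]; abel
    rw [this]
    exact Y.add_mem h1 (Y.add_mem h2 h3)

/-- Corollary 2.10: for an odd prime `p` and a separable `p`-group `G`, minimal characteristic
inertia implies minimal full inertia. -/
theorem stmt_9 {G : Type*} [AddCommGroup G] (p : ℕ) (hp : p.Prime) (hodd : p ≠ 2)
    (hG : IsPGroup' p G) (hsep : SeparableP p G)
    (hmin : MinCharInertia G) :
    MinFullInertia G := by
  intro X hX
  obtain ⟨Y, hY, hXY⟩ := hmin X (fun φ => hX φ.toAddMonoidHom)
  refine ⟨Y, ?_, hXY⟩
  rintro φ _ ⟨x, hx, rfl⟩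
  obtain ⟨n, hn⟩ := hG x
  exact aux_fi p hp hodd hG hsep Y hY φ n x hx hn
end

section
/- Let p be a prime, L an abelian p-group, and B ⊆ C subgroups of L. For every natural number k, B and C are commensurable if, and only if, B[pᵏ] and C[pᵏ] are commensurable and pᵏB and pᵏC are commensurable. -/
theorem commens_iff_of_le {G : Type*} [AddCommGroup G] {X Y : AddSubgroup G} (h : X ≤ Y) :
    Commens X Y ↔ X.relIndex Y ≠ 0 := by
  unfold Commens
  rw [inf_eq_left.mpr h]
  change X.relIndex X ≠ 0 ∧ X.relIndex Y ≠ 0 ↔ _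
  simp

theorem relIndex_split {G : Type*} [AddCommGroup G] (f : G →+ G) {B C : AddSubgroup G}
    (h : B ≤ C) :
    (B ⊓ f.ker).relIndex (C ⊓ f.ker) * (B.map f).relIndex (C.map f) = B.relIndex C := by
  have h1 : (B.map f).relIndex (C.map f) = (B ⊔ f.ker).relIndex C := by
    rw [AddSubgroup.relIndex_map_map]
    have : C ⊔ f.ker = C ⊔ (B ⊔ f.ker) := by
      rw [← sup_assoc, sup_eq_left.mpr h]
    rw [this, AddSubgroup.relIndex_sup_right]
  have h2 : (B ⊓ f.ker).relIndex (C ⊓ f.ker) = B.relIndex ((B ⊔ f.ker) ⊓ C) := by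
    rw [sup_inf_assoc_of_le _ h, AddSubgroup.relIndex_sup_left, inf_comm f.ker C,
      ← AddSubgroup.inf_relIndex_right B (C ⊓ f.ker), ← inf_assoc, inf_eq_left.mpr h]
  rw [h1, h2, AddSubgroup.relIndex_inf_mul_relIndex, inf_eq_left.mpr le_sup_left]

/-- Lemma 2.12(a): for subgroups `B ⊆ C` of a `p`-group `L` and `k ∈ ℕ`, `B ∼ C` iff
`B[pᵏ] ∼ C[pᵏ]` and `pᵏB ∼ pᵏC`. -/
theorem stmt_11 {L : Type*} [AddCommGroup L] (p : ℕ) (hp : p.Prime) (hL : IsPGroup' p L)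
    (B C : AddSubgroup L) (hBC : B ≤ C) (k : ℕ) :
    Commens B C ↔
      (Commens (torSub (p ^ k) B) (torSub (p ^ k) C) ∧
        Commens (smulSub (p ^ k) B) (smulSub (p ^ k) C)) := by
  have h1 : torSub (p ^ k) B ≤ torSub (p ^ k) C := inf_le_inf_right _ hBC
  have h2 : smulSub (p ^ k) B ≤ smulSub (p ^ k) C := AddSubgroup.map_mono hBC
  rw [commens_iff_of_le hBC, commens_iff_of_le h1, commens_iff_of_le h2,
    ← relIndex_split (smulHom (p ^ k)) hBC, mul_ne_zero_iff]
  rfl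
end

section
/- Let p be a prime, L an abelian p-group, and B, C subgroups of L. If n is a natural number with B[pⁿ] ⊆ C[pⁿ], then B[pⁿ] and C[pⁿ] are commensurable if, and only if, (pᵏB)[p] and (pᵏC)[p] are commensurable for all k < n. -/
theorem relIndex_map_ne_zero {G : Type*} [AddCommGroup G] {X Y : AddSubgroup G} (f : G →+ G)
    (h : X.relIndex Y ≠ 0) : (X.map f).relIndex (Y.map f) ≠ 0 := by
  rw [← AddSubgroup.relIndex_comap]
  intro h0
  exact h (AddSubgroup.relIndex_eq_zero_of_le_left (AddSubgroup.le_comap_map f X) h0)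

theorem relIndex_ne_zero_of_map {G : Type*} [AddCommGroup G] {X Y : AddSubgroup G} (f : G →+ G)
    (hXY : X ≤ Y) (h1 : (X.map f).relIndex (Y.map f) ≠ 0)
    (h2 : X.relIndex (Y ⊓ f.ker) ≠ 0) : X.relIndex Y ≠ 0 := by
  rw [← AddSubgroup.relIndex_comap, AddSubgroup.comap_map_eq] at h1
  have h3 : X.relIndex ((X ⊔ f.ker) ⊓ Y) ≠ 0 := by
    rw [sup_inf_assoc_of_le _ hXY, AddSubgroup.relIndex_sup_left, inf_comm]
    exact h2
  have h4 := AddSubgroup.relIndex_inf_mul_relIndex X (X ⊔ f.ker) Y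
  rw [inf_eq_left.mpr (le_sup_left : X ≤ X ⊔ f.ker)] at h4
  rw [← h4]
  exact mul_ne_zero h3 h1

theorem mem_torSub_iff {G : Type*} [AddCommGroup G] {m : ℕ} {B : AddSubgroup G} {x : G} :
    x ∈ torSub m B ↔ x ∈ B ∧ m • x = 0 := Iff.rfl

theorem torSub_smulSub {G : Type*} [AddCommGroup G] (p k : ℕ) (B : AddSubgroup G) :
    torSub p (smulSub (p ^ k) B) = (torSub (p ^ (k + 1)) B).map (smulHom (p ^ k)) := by
  ext x
  constructor
  · rintro ⟨⟨b, hb, rfl⟩, h⟩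
    refine ⟨b, mem_torSub_iff.mpr ⟨hb, ?_⟩, rfl⟩
    rw [pow_succ', mul_smul]
    exact h
  · rintro ⟨b, hb, rfl⟩
    obtain ⟨hb, h⟩ := mem_torSub_iff.mp hb
    refine ⟨⟨b, hb, rfl⟩, ?_⟩
    rw [pow_succ', mul_smul] at h
    exact h

theorem torSub_inf_ker {G : Type*} [AddCommGroup G] (p : ℕ) {k n : ℕ} (hk : k ≤ n)
    (B : AddSubgroup G) :
    torSub (p ^ n) B ⊓ (smulHom (p ^ k)).ker = torSub (p ^ k) B := by
  ext x
  constructor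
  · rintro ⟨⟨hb, _⟩, h⟩
    exact ⟨hb, h⟩
  · rintro ⟨hb, h⟩
    refine ⟨⟨hb, ?_⟩, h⟩
    change p ^ n • x = 0
    have h' : p ^ k • x = 0 := h
    rw [← Nat.sub_add_cancel hk, pow_add, mul_smul, h', smul_zero]

/-- Lemma 2.12(b): for subgroups `B, C` of a `p`-group `L` with `B[pⁿ] ⊆ C[pⁿ]`,
`B[pⁿ] ∼ C[pⁿ]` iff `(pᵏB)[p] ∼ (pᵏC)[p]` for all `k < n`. -/
theorem stmt_12 {L : Type*} [AddCommGroup L] (p : ℕ) (hp : p.Prime) (hL : IsPGroup' p L)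
    (B C : AddSubgroup L) (n : ℕ) (hBC : torSub (p ^ n) B ≤ torSub (p ^ n) C) :
    Commens (torSub (p ^ n) B) (torSub (p ^ n) C) ↔
      ∀ k < n, Commens (torSub p (smulSub (p ^ k) B)) (torSub p (smulSub (p ^ k) C)) := by
  have hle : ∀ k ≤ n, torSub (p ^ k) B ≤ torSub (p ^ k) C := by
    intro k hk
    rw [← torSub_inf_ker p hk B, ← torSub_inf_ker p hk C]
    exact inf_le_inf_right _ hBC
  have key : ∀ k < n, (Commens (torSub p (smulSub (p ^ k) B)) (torSub p (smulSub (p ^ k) C)) ↔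
      ((torSub (p ^ (k + 1)) B).map (smulHom (p ^ k))).relIndex
        ((torSub (p ^ (k + 1)) C).map (smulHom (p ^ k))) ≠ 0) := by
    intro k hk
    rw [torSub_smulSub, torSub_smulSub]
    exact commens_iff_of_le (AddSubgroup.map_mono (hle (k + 1) hk))
  rw [commens_iff_of_le hBC]
  constructor
  · intro h k hk
    rw [key k hk]
    apply relIndex_map_ne_zero
    rw [← torSub_inf_ker p (show k + 1 ≤ n from hk) B, ← torSub_inf_ker p (show k + 1 ≤ n from hk) C]
    exact AddSubgroup.relIndex_inter_ne_zero h _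
  · intro h
    have ind : ∀ k ≤ n, (torSub (p ^ k) B).relIndex (torSub (p ^ k) C) ≠ 0 := by
      intro k
      induction k with
      | zero =>
        intro _
        have h0 : torSub (p ^ 0) C ≤ torSub (p ^ 0) B := by
          intro x hx
          have := (mem_torSub_iff.mp hx).2
          rw [pow_zero, one_smul] at this
          rw [this]
          exact zero_mem _
        rw [AddSubgroup.relIndex_eq_one.mpr h0]
        exact one_ne_zero
      | succ k ih =>
        intro hk
        refine relIndex_ne_zero_of_map (smulHom (p ^ k)) (hle _ hk) ((key k hk).mp (h k hk)) ?_
        rw [torSub_inf_ker p (Nat.le_succ k)]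
        intro h0
        refine ih (by omega) (AddSubgroup.relIndex_eq_zero_of_le_left ?_ h0)
        rw [← torSub_inf_ker p (Nat.le_succ k) B]
        exact inf_le_left
    exact ind n le_rfl
end

section
/- Let G be an abelian group with a direct sum decomposition G = V ⊕ W (internal direct sum of subgroups V and W), let γ : V → W be an additive homomorphism, and let φ_γ be the automorphism of G given by φ_γ(v + w) = v + γ(v) + w for v ∈ V, w ∈ W. Let X be a subgroup of G. If there are elements v_j ∈ V ∩ X for j ∈ ℕ such that the elements w_j = γ(v_j) ∈ W represent pairwise distinct cosets of X in G, then the image of φ_γ(X) in G/X is infinite; in particular, X is not characteristically inert in G. -/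
/-- Claim (Sheer automorphisms), part (a): if `G = V ⊕ W`, `γ : V → W`, `φ_γ` is the
automorphism `v + w ↦ v + γ(v) + w`, and there are elements `v_j ∈ V ∩ X` whose images
`w_j = γ(v_j)` lie in pairwise distinct cosets of `X`, then `φ̂_γ(X)` is infinite; in
particular `X` is not characteristically inert in `G`. -/
theorem stmt_15 {G : Type*} [AddCommGroup G] (V W : AddSubgroup G) (hVW : IsCompl V W)
    (γ : V →+ W) (φ : G ≃+ G)
    (hφ : ∀ (v : V) (w : W), φ ((v : G) + (w : G)) = (v : G) + ((γ v : W) : G) + (w : G))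
    (X : AddSubgroup G) (v : ℕ → V) (hvX : ∀ j, (v j : G) ∈ X)
    (hdist : ∀ j l, j ≠ l → ((γ (v j) : G) - ((γ (v l) : G))) ∉ X) :
    Infinite (hatImage X φ.toAddMonoidHom) ∧ ¬ CharInertSub X := by
  have hinf : Infinite (hatImage X φ.toAddMonoidHom) := by
    have hv : ∀ j, φ (v j : G) = (v j : G) + (γ (v j) : G) := by
      intro j
      have h := hφ (v j) 0
      simpa using h
    refine Infinite.of_injective (fun j : ℕ =>
      (⟨QuotientAddGroup.mk' X (φ (v j : G)),
        ⟨φ (v j : G), ⟨(v j : G), hvX j, rfl⟩, rfl⟩⟩ : hatImage X φ.toAddMonoidHom)) ?_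
    intro j l hjl
    by_contra hne
    have h1 : QuotientAddGroup.mk' X (φ (v j : G)) = QuotientAddGroup.mk' X (φ (v l : G)) :=
      congrArg Subtype.val hjl
    have h2 : -(φ (v j : G)) + φ (v l : G) ∈ X := QuotientAddGroup.eq.mp h1
    rw [hv, hv] at h2
    apply hdist l j (Ne.symm hne)
    have h3 := X.add_mem h2 (X.sub_mem (hvX j) (hvX l))
    convert h3 using 1
    abel
  exact ⟨hinf, fun h => (not_finite_iff_infinite.mpr hinf) (h φ)⟩
end

section
/- For every prime p there exists an abelian p-group that has neither minimal full inertia nor minimal characteristic inertia. -/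
namespace Stmt16

/-- The full product of the cyclic groups of order `p^(i+1)`. -/
abbrev P (p : ℕ) : Type := (i : ℕ) → ZMod (p ^ (i + 1))

/-- The torsion-complete group: the `p`-torsion part of the product. -/
def T (p : ℕ) : AddSubgroup (P p) where
  carrier := {x | ∃ n : ℕ, p ^ n • x = 0}
  zero_mem' := ⟨0, by simp⟩
  add_mem' := by
    rintro a b ⟨n, hn⟩ ⟨m, hm⟩
    refine ⟨n + m, ?_⟩
    rw [smul_add, pow_add, mul_smul, mul_smul, hm, smul_zero, add_zero, smul_comm, hn, smul_zero]
  neg_mem' := by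
    rintro a ⟨n, hn⟩
    exact ⟨n, by rw [smul_neg, hn, neg_zero]⟩

/-- The direct sum of the cyclic groups of order `p^(i+1)`. -/
abbrev S (p : ℕ) : Type := Π₀ i : ℕ, ZMod (p ^ (i + 1))

lemma zmod_div (p : ℕ) (hp : p.Prime) (i n : ℕ) (hn : n ≤ i) (x : ZMod (p ^ (i + 1)))
    (hx : p • x = 0) : ∃ y : ZMod (p ^ (i + 1)), x = p ^ n • y := by
  have : NeZero (p ^ (i + 1)) := ⟨pow_ne_zero _ hp.ne_zero⟩
  obtain ⟨k, rfl⟩ := ZMod.natCast_zmod_surjective x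
  rw [nsmul_eq_mul, ← Nat.cast_mul, ZMod.natCast_eq_zero_iff, pow_succ', ] at hx
  have h2 : p ^ i ∣ k := Nat.dvd_of_mul_dvd_mul_left hp.pos hx
  obtain ⟨c, rfl⟩ := (pow_dvd_pow p hn).trans h2
  exact ⟨c, by rw [nsmul_eq_mul]; push_cast; rfl⟩

lemma pow_smul_zmod (p i n : ℕ) (h : i < n) (z : ZMod (p ^ (i + 1))) : p ^ n • z = 0 := by
  have : ((p ^ n : ℕ) : ZMod (p ^ (i + 1))) = 0 := by
    rw [ZMod.natCast_eq_zero_iff]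
    exact pow_dvd_pow p h
  rw [nsmul_eq_mul, this, zero_mul]

lemma height (p : ℕ) (hp : p.Prime) (φ : T p →+ S p) (n : ℕ) (x : T p) (hx : p • x = 0)
    (h0 : ∀ i < n, x.1 i = 0) : ∀ i < n, φ x i = 0 := by
  have hx' : ∀ i, p • x.1 i = 0 := fun i => congrFun (congrArg Subtype.val hx) i
  have : ∀ i, ∃ y : ZMod (p ^ (i + 1)), x.1 i = p ^ n • y := by
    intro i
    rcases lt_or_ge i n with h | h
    · exact ⟨0, by rw [h0 i h, smul_zero]⟩
    · exact zmod_div p hp i n h _ (hx' i)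
  choose y hy using this
  have hyT : (y : P p) ∈ T p := by
    refine ⟨n + 1, ?_⟩
    funext i
    have := hx' i
    rw [hy i, ← mul_smul, ← pow_succ'] at this
    exact this
  have hxy : x = p ^ n • (⟨y, hyT⟩ : T p) := by
    apply Subtype.ext
    funext i
    exact hy i
  intro i hi
  rw [hxy, map_nsmul, DFinsupp.smul_apply]
  exact pow_smul_zmod p i n hi _

lemma bdd (p : ℕ) (s : S p) : ∃ N, ∀ i ≥ N, s i = 0 := by
  classical
  refine ⟨s.support.sup id + 1, fun i hi => ?_⟩
  by_contra h
  have : i ≤ s.support.sup id := Finset.le_sup (f := id) (DFinsupp.mem_support_iff.2 h)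
  omega

lemma small (p : ℕ) (hp : p.Prime) (φ : T p →+ S p) :
    ∃ n, ∀ x : T p, p • x = 0 → (∀ i < n, x.1 i = 0) → φ x = 0 := by
  by_contra! hcon
  choose f hf1 hf2 hf3 using hcon
  choose b hb using bdd p
  let N : ℕ → ℕ := fun k => Nat.rec 0 (fun _ m => max (m + 1) (b (φ (f m)))) k
  have hN : ∀ k, N (k + 1) = max (N k + 1) (b (φ (f (N k)))) := fun k => rfl
  have hmono : StrictMono N := strictMono_nat_of_lt_succ (fun k => by rw [hN]; omega)
  have hle : ∀ k, k ≤ N k := fun k => hmono.le_apply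
  have hz : ∀ k i, i < N k → (f (N k)).1 i = 0 := fun k i h => hf2 _ i h
  let x : P p := fun i => ∑ k ∈ Finset.range (i + 1), (f (N k)).1 i
  have hfp : ∀ k i, p • (f (N k)).1 i = 0 :=
    fun k i => congrFun (congrArg Subtype.val (hf1 (N k))) i
  have hpx : p • x = 0 := by
    funext i
    change p • (∑ k ∈ Finset.range (i + 1), (f (N k)).1 i) = 0
    rw [Finset.smul_sum]
    exact Finset.sum_eq_zero fun k _ => hfp k i
  let X : T p := ⟨x, 1, by rw [pow_one]; exact hpx⟩
  have hpX : p • X = 0 := Subtype.ext hpx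
  have htail : ∀ K, ∀ i < N K, φ (X - ∑ k ∈ Finset.range K, f (N k)) i = 0 := by
    intro K
    apply height p hp
    · rw [smul_sub, hpX, Finset.smul_sum, Finset.sum_eq_zero (fun k _ => hf1 (N k)), sub_zero]
    · intro i hi
      have : (X - ∑ k ∈ Finset.range K, f (N k)).1 i
          = x i - ∑ k ∈ Finset.range K, (f (N k)).1 i := by
        simp [X, Finset.sum_apply]
      rw [this, sub_eq_zero]
      change ∑ k ∈ Finset.range (i + 1), (f (N k)).1 i = _
      have e1 : ∑ k ∈ Finset.range (i + 1), (f (N k)).1 i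
          = ∑ k ∈ Finset.range (max (i + 1) K), (f (N k)).1 i := by
        apply Finset.sum_subset
        · intro k; simp only [Finset.mem_range]; omega
        · intro k _ hk
          simp only [Finset.mem_range] at hk
          exact hz k i (by have := hle k; omega)
      have e2 : ∑ k ∈ Finset.range K, (f (N k)).1 i
          = ∑ k ∈ Finset.range (max (i + 1) K), (f (N k)).1 i := by
        apply Finset.sum_subset
        · intro k; simp only [Finset.mem_range]; omega
        · intro k _ hk
          simp only [Finset.mem_range] at hk
          exact hz k i (by have := hmono.monotone (show K ≤ k by omega); omega)
      rw [e1, e2]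
  obtain ⟨M, hM⟩ := bdd p (φ X)
  have hne : ∃ m, φ (f (N M)) m ≠ 0 := by
    by_contra! h
    exact hf3 (N M) (DFinsupp.ext h)
  obtain ⟨m, hm⟩ := hne
  have hm1 : N M ≤ m := by
    by_contra h
    exact hm (height p hp φ (N M) _ (hf1 _) (hf2 _) m (by omega))
  have hm2 : m < N (M + 1) := by
    by_contra h
    exact hm (hb _ m (by rw [hN] at h; omega))
  have h1 := htail (M + 1) m hm2
  rw [map_sub, map_sum, DFinsupp.sub_apply, DFinsupp.finsetSum_apply, Finset.sum_range_succ,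
    hM m (by have := hle M; omega), Finset.sum_eq_zero, zero_add, zero_sub, neg_eq_zero] at h1
  · exact hm h1
  · intro k hk
    rw [Finset.mem_range] at hk
    apply hb
    have h2 := hmono.monotone (show k + 1 ≤ M by omega)
    rw [hN] at h2
    omega

/-- The group of the example. -/
abbrev G (p : ℕ) : Type := T p × S p

/-- The subgroup `T[p]` of `G`. -/
def X (p : ℕ) : AddSubgroup (G p) where
  carrier := {g | p • g.1 = 0 ∧ g.2 = 0}
  zero_mem' := by simp
  add_mem' := by
    rintro a b ⟨h1, h2⟩ ⟨h3, h4⟩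
    exact ⟨by simp [smul_add, h1, h3], by simp [h2, h4]⟩
  neg_mem' := by
    rintro a ⟨h1, h2⟩
    exact ⟨by simp [h1], by simp [h2]⟩

lemma mem_X (p : ℕ) (g : G p) : g ∈ X p ↔ p • g.1 = 0 ∧ g.2 = 0 := Iff.rfl

lemma X_inert (p : ℕ) (hp : p.Prime) : FullyInertSub (X p) := by
  intro φ
  obtain ⟨n, hn⟩ := small p hp
    ((AddMonoidHom.snd (T p) (S p)).comp (φ.comp (AddMonoidHom.inl (T p) (S p))))
  have : ∀ i : ℕ, NeZero (p ^ (i + 1)) := fun i => ⟨pow_ne_zero _ hp.ne_zero⟩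
  let r : X p → ((i : Fin n) → ZMod (p ^ (i.1 + 1))) := fun g i => g.1.1.1 i
  let q : X p → G p ⧸ X p := fun g => QuotientAddGroup.mk' (X p) (φ g.1)
  have hqr : q.FactorsThrough r := by
    intro g g' h
    have hd : g.1 - g'.1 ∈ X p := (X p).sub_mem g.2 g'.2
    have hd0 : g.1 - g'.1 = (g.1.1 - g'.1.1, 0) := Prod.ext rfl hd.2
    have hk := hn (g.1.1 - g'.1.1) hd.1 (fun i hi => by
      have := congrFun h ⟨i, hi⟩
      exact sub_eq_zero.2 this)
    symm
    apply QuotientAddGroup.eq.2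
    rw [neg_add_eq_sub, ← map_sub, mem_X]
    constructor
    · rw [← Prod.smul_fst, ← map_nsmul]
      have : p • (g.1 - g'.1) = 0 := by
        rw [hd0]
        exact Prod.ext hd.1 (smul_zero _)
      rw [this, map_zero]; rfl
    · rw [hd0]; exact hk
  have hfin : (Set.range q).Finite := by
    have : q = (Function.extend r q 0) ∘ r := by
      funext a
      exact (hqr.extend_apply 0 a).symm
    rw [this]
    exact (Set.finite_range (Function.extend r q 0)).subset (Set.range_comp_subset_range _ _)
  refine (hfin.subset ?_).to_subtype
  rintro _ ⟨_, ⟨g, hg, rfl⟩, rfl⟩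
  exact ⟨⟨g, hg⟩, rfl⟩

lemma pigeon {A I : Type*} [AddCommGroup A] [Infinite I] (H K : AddSubgroup A)
    (h : (K.addSubgroupOf H).index ≠ 0) (f : I → A) (hf : ∀ i, f i ∈ H) :
    ∃ i, Infinite {j // f j - f i ∈ K} := by
  have : (K.addSubgroupOf H).FiniteIndex := ⟨h⟩
  have : Finite (H ⧸ K.addSubgroupOf H) := AddSubgroup.finite_quotient_of_finiteIndex
  let q : I → H ⧸ K.addSubgroupOf H := fun i => QuotientAddGroup.mk (⟨f i, hf i⟩ : H)
  obtain ⟨y, hy⟩ := Finite.exists_infinite_fiber q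
  obtain ⟨⟨i, hi⟩⟩ := (inferInstance : Nonempty (q ⁻¹' {y}))
  refine ⟨i, ?_⟩
  refine Infinite.of_injective (fun j : q ⁻¹' {y} => (⟨j.1, ?_⟩ : {j // f j - f i ∈ K})) ?_
  · have hj : q i = q j.1 := by rw [show q i = y from hi, show q j.1 = y from j.2]
    have := QuotientAddGroup.eq.1 hj
    rw [AddSubgroup.mem_addSubgroupOf] at this
    rw [sub_eq_neg_add]
    exact this
  · intro a b hab
    exact Subtype.ext (congrArg (fun z => z.1) hab)

/-- Shear automorphism. -/
def shear (p n : ℕ) : G p ≃+ G p where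
  toFun g := (g.1, g.2 + DFinsupp.single n (g.1.1 n))
  invFun g := (g.1, g.2 - DFinsupp.single n (g.1.1 n))
  left_inv g := by simp
  right_inv g := by simp
  map_add' a b := by
    refine Prod.ext rfl ?_
    simp only [Prod.snd_add, Prod.fst_add, AddSubgroup.coe_add, Pi.add_apply, DFinsupp.single_add]
    abel

lemma X_not (p : ℕ) (hp : p.Prime) (Y : AddSubgroup (G p)) (hY : CharacteristicSub Y)
    (hc : Commens (X p) Y) : False := by
  obtain ⟨h1, h2⟩ := hc
  have hc0 : ∀ n, ((p ^ n : ℕ) : ZMod (p ^ (n + 1))) ≠ 0 := by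
    intro n h
    rw [ZMod.natCast_eq_zero_iff, Nat.pow_dvd_pow_iff_le_right hp.one_lt] at h
    omega
  have hpe : ∀ n, p • (Pi.single n ((p ^ n : ℕ) : ZMod (p ^ (n + 1))) : P p) = 0 := by
    intro n
    rw [← Pi.single_smul, nsmul_eq_mul, ← Nat.cast_mul, ← pow_succ', ZMod.natCast_self,
      Pi.single_zero]
  let e : ℕ → T p := fun n => ⟨Pi.single n ((p ^ n : ℕ) : ZMod (p ^ (n + 1))), 1, by
    rw [pow_one]; exact hpe n⟩
  obtain ⟨a, ha⟩ := pigeon (X p) (X p ⊓ Y) h1 (fun n => ((e n, 0) : G p))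
    (fun n => ⟨Subtype.ext (hpe n), rfl⟩)
  have key : ∀ n, n ≠ a → ((e n, 0) : G p) - (e a, 0) ∈ X p ⊓ Y →
      ((0, DFinsupp.single n ((p ^ n : ℕ) : ZMod (p ^ (n + 1)))) : G p) ∈ Y := by
    intro n hna hn
    have h3 : shear p n (((e n, 0) : G p) - (e a, 0)) ∈ Y := hY (shear p n) ⟨_, hn.2, rfl⟩
    have h4 := Y.sub_mem h3 hn.2
    have hval : (e n - e a).1 n = ((p ^ n : ℕ) : ZMod (p ^ (n + 1))) := by
      change (Pi.single n _ : P p) n - (Pi.single a _ : P p) n = _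
      rw [Pi.single_eq_same, Pi.single_eq_of_ne hna, sub_zero]
    convert h4 using 1
    refine Prod.ext ?_ ?_
    · simp [shear]
    · change _ = ((0 : S p) - 0) + DFinsupp.single n ((e n - e a).1 n) - ((0 : S p) - 0)
      rw [hval]; simp
  let A := {n : ℕ | n ≠ a ∧ ((e n, 0) : G p) - (e a, 0) ∈ X p ⊓ Y}
  have hA : A.Infinite := by
    have h5 : {n : ℕ | ((e n, 0) : G p) - (e a, 0) ∈ X p ⊓ Y}.Infinite :=
      Set.infinite_coe_iff.1 ha
    refine (h5.sdiff (Set.finite_singleton a)).mono ?_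
    rintro n ⟨h6, h7⟩
    exact ⟨h7, h6⟩
  have := hA.to_subtype
  obtain ⟨i, hi⟩ := pigeon Y (X p ⊓ Y) h2
    (fun n : A => ((0, DFinsupp.single n.1 ((p ^ n.1 : ℕ) : ZMod (p ^ (n.1 + 1)))) : G p))
    (fun n => key n.1 n.2.1 n.2.2)
  obtain ⟨j, hj, hji⟩ := Set.Infinite.exists_notMem_finset (Set.infinite_coe_iff.1 hi) {i}
  have hne : j.1 ≠ i.1 := fun h => hji (by simpa using Subtype.ext h)
  have h8 : (DFinsupp.single j.1 ((p ^ j.1 : ℕ) : ZMod (p ^ (j.1 + 1))) : S p)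
      - DFinsupp.single i.1 ((p ^ i.1 : ℕ) : ZMod (p ^ (i.1 + 1))) = 0 := hj.1.2
  have h9 := DFunLike.congr_fun h8 j.1
  rw [DFinsupp.sub_apply, DFinsupp.single_eq_same, DFinsupp.single_eq_of_ne hne, sub_zero] at h9
  exact hc0 _ h9

lemma G_p (p : ℕ) : IsPGroup' p (G p) := by
  rintro ⟨⟨x, n, hn⟩, s⟩
  obtain ⟨N, hN⟩ := bdd p s
  refine ⟨N + n, Prod.ext (Subtype.ext ?_) (DFinsupp.ext fun i => ?_)⟩
  · change p ^ (N + n) • x = 0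
    rw [pow_add, mul_smul, hn, smul_zero]
  · change (p ^ (N + n) • s) i = 0
    rw [DFinsupp.smul_apply]
    rcases lt_or_ge i N with h | h
    · exact pow_smul_zmod p i _ (by omega) _
    · rw [hN i h, smul_zero]

end Stmt16

/-- Example 3.1: for every prime `p` there is a `p`-group with neither minimal full inertia
nor minimal characteristic inertia. -/
theorem stmt_16 (p : ℕ) (hp : p.Prime) :
    ∃ (G : Type) (_ : AddCommGroup G), IsPGroup' p G ∧
      ¬ MinFullInertia G ∧ ¬ MinCharInertia G := by
  exact ⟨Stmt16.G p, inferInstance, Stmt16.G_p p,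
    fun h => by
      obtain ⟨Y, hY, hc⟩ := h _ (Stmt16.X_inert p hp)
      exact Stmt16.X_not p hp Y (fun φ => hY φ.toAddMonoidHom) hc,
    fun h => by
      obtain ⟨Y, hY, hc⟩ := h _ (fun φ => Stmt16.X_inert p hp φ.toAddMonoidHom)
      exact Stmt16.X_not p hp Y hY hc⟩
end
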